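/- arXiv:2004.12523 — 2 statements merged into one kernel-verified Lean document; each statement's English description precedes it below -/
import Mathlib

section
/- Let 0 < δ < λ₀ and let G₀ : ℝ → ℝ be continuous on [0, λ₀], twice differentiable on (0, λ₀) with G₀''(λ) < 0 for all λ ∈ (0, λ₀), with G₀(0) = 0, G₀(λ₀) = 0 and G₀(λ) > 0 on (0, λ₀). Then there exist λ₁ ∈ (λ₀ - δ, λ₀) and η > 0 with the following property: every function G : ℝ → ℝ that is continuous on [λ₁, λ₁ + δ], differentiable on [λ₁, λ₁ + δ), twice differentiable on (λ₁, λ₁ + δ) with G'' ≤ 0 there, and satisfies G(λ₁) ≥ 0, |G(λ₁) - G₀(λ₁)| < η and |G'(λ₁) - G₀'(λ₁)| < η, has a zero at some λ₂ ∈ [λ₁, λ₁ + δ]. -/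
/-- Analytic core of the paper's Lemma 3.1: near the second zero
`λ₀` of the reference concave function `G₀` there is a parameter `λ₁` and a
tolerance `η > 0` such that every concave function with data `η`-close to that
of `G₀` at `λ₁` develops a zero within parameter distance `δ`. -/
theorem stmt_5 (lam0 δ : ℝ) (hδ : 0 < δ) (hδl : δ < lam0) (G0 : ℝ → ℝ)
    (hcont0 : ContinuousOn G0 (Set.Icc 0 lam0))
    (hdiff0 : ∀ x ∈ Set.Ioo 0 lam0, DifferentiableAt ℝ G0 x)
    (hdiff0' : ∀ x ∈ Set.Ioo 0 lam0, DifferentiableAt ℝ (deriv G0) x)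
    (hconc0 : ∀ x ∈ Set.Ioo 0 lam0, deriv (deriv G0) x < 0)
    (h00 : G0 0 = 0) (h0l : G0 lam0 = 0)
    (hpos0 : ∀ x ∈ Set.Ioo 0 lam0, 0 < G0 x) :
    ∃ lam1 ∈ Set.Ioo (lam0 - δ) lam0, ∃ η > (0:ℝ),
      ∀ G G' : ℝ → ℝ,
        ContinuousOn G (Set.Icc lam1 (lam1 + δ)) →
        (∀ x ∈ Set.Ico lam1 (lam1 + δ),
          HasDerivWithinAt G (G' x) (Set.Icc lam1 (lam1 + δ)) x) →
        (∀ x ∈ Set.Ioo lam1 (lam1 + δ), DifferentiableAt ℝ G' x) →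
        (∀ x ∈ Set.Ioo lam1 (lam1 + δ), deriv G' x ≤ 0) →
        0 ≤ G lam1 →
        |G lam1 - G0 lam1| < η →
        |G' lam1 - deriv G0 lam1| < η →
        ∃ lam2 ∈ Set.Icc lam1 (lam1 + δ), G lam2 = 0 := by
  obtain ⟨c, hc, hc2⟩ : ∃ c ∈ Set.Ioo (lam0 - δ) lam0, G0 c + δ * deriv G0 c < 0 := by
    have hsub : Set.Icc (lam0 - δ) lam0 ⊆ Set.Icc 0 lam0 := Set.Icc_subset_Icc (by linarith) le_rfl
    obtain ⟨c, hc, h⟩ := exists_hasDerivAt_eq_slope (fun x => G0 x * Real.exp (x / δ))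
      (fun x => deriv G0 x * Real.exp (x / δ) + G0 x * (Real.exp (x / δ) * (1 / δ)))
      (show lam0 - δ < lam0 by linarith)
      ((hcont0.mono hsub).mul (by fun_prop))
      (fun x hx => ((hdiff0 x ⟨by linarith [hx.1], hx.2⟩).hasDerivAt).mul
        (((hasDerivAt_id x).div_const δ).exp))
    refine ⟨c, hc, ?_⟩
    have h1 := hpos0 (lam0 - δ) ⟨by linarith, by linarith⟩
    have h2 : deriv G0 c * Real.exp (c / δ) + G0 c * (Real.exp (c / δ) * (1 / δ)) < 0 := by
      rw [h]
      apply div_neg_of_neg_of_pos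
      · simp only [h0l, zero_mul, zero_sub]
        have := mul_pos h1 (Real.exp_pos ((lam0 - δ) / δ))
        linarith
      · linarith
    have h3 : deriv G0 c * Real.exp (c / δ) + G0 c * (Real.exp (c / δ) * (1 / δ))
        = (G0 c + δ * deriv G0 c) * (Real.exp (c / δ) / δ) := by
      field_simp
      ring
    rw [h3] at h2
    by_contra hn
    have := mul_nonneg (not_lt.mp hn) (div_pos (Real.exp_pos (c / δ)) hδ).le
    linarith
  refine ⟨c, hc, -(G0 c + δ * deriv G0 c) / (1 + δ), div_pos (by linarith) (by linarith), ?_⟩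
  intro G G' hG hG' hd hd2 h0 ha hb
  set η := -(G0 c + δ * deriv G0 c) / (1 + δ) with hη
  have hη2 : η * (1 + δ) = -(G0 c + δ * deriv G0 c) := by
    rw [hη]; field_simp
  have hconc : ConcaveOn ℝ (Set.Icc c (c + δ)) G := by
    apply concaveOn_of_hasDerivWithinAt2_nonpos (convex_Icc _ _) hG (f' := G') (f'' := deriv G')
    · intro x hx
      exact (hG' x (by rw [interior_Icc] at hx; exact ⟨hx.1.le, hx.2⟩)).mono interior_subset
    · intro x hx
      rw [interior_Icc] at hx
      exact (hd x hx).hasDerivAt.hasDerivWithinAt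
    · intro x hx
      rw [interior_Icc] at hx
      exact hd2 x hx
  have hs := hconc.slope_le_of_hasDerivWithinAt (x := c) (y := c + δ) ⟨le_rfl, by linarith⟩
    ⟨by linarith, le_rfl⟩ (by linarith) (hG' c ⟨le_rfl, by linarith⟩)
  rw [slope_def_field, div_le_iff₀ (by linarith)] at hs
  have hb2 := mul_lt_mul_of_pos_right (abs_lt.mp hb).2 hδ
  have hneg : G (c + δ) ≤ 0 := by
    have := (abs_lt.mp ha).2
    nlinarith
  exact intermediate_value_Icc' (by linarith) hG ⟨hneg, h0⟩
end

section
/- Let λ₁ ∈ ℝ, δ > 0 and M ≥ 0 with δ·M ≤ 1/2. Let I : ℝ → ℝ satisfy |I(λ)| ≤ M for all λ ∈ [λ₁, λ₁ + 4δ], and let u : ℝ → ℝ be continuous on [λ₁, λ₁ + 4δ] and differentiable on [λ₁, λ₁ + 4δ] with u'(λ) = -(u(λ)·I(λ) - 1)² for all λ ∈ [λ₁, λ₁ + 4δ]. If 0 ≤ u(λ₁) ≤ δ, then there exists λ ∈ [λ₁, λ₁ + 4δ] with u(λ) = 0. -/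
/-- Analytic core of the paper's Lemma 4.1: if `u` satisfies
`u' = -(uI - 1)²` with `|I| ≤ M`, `δ·M ≤ 1/2`, and `0 ≤ u(λ₁) ≤ δ`, then `u`
reaches zero within the interval `[λ₁, λ₁ + 4δ]`. -/
theorem stmt_12 (lam1 δ M : ℝ) (hδ : 0 < δ) (hM : 0 ≤ M) (hδM : δ * M ≤ 1 / 2)
    (I u : ℝ → ℝ)
    (hI : ∀ x ∈ Set.Icc lam1 (lam1 + 4 * δ), |I x| ≤ M)
    (hcont : ContinuousOn u (Set.Icc lam1 (lam1 + 4 * δ)))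
    (hu : ∀ x ∈ Set.Icc lam1 (lam1 + 4 * δ),
        HasDerivWithinAt u (-(u x * I x - 1) ^ 2) (Set.Icc lam1 (lam1 + 4 * δ)) x)
    (h0 : 0 ≤ u lam1) (h1 : u lam1 ≤ δ) :
    ∃ x ∈ Set.Icc lam1 (lam1 + 4 * δ), u x = 0 := by
  by_contra hne
  push Not at hne
  have hle : lam1 ≤ lam1 + 4 * δ := by linarith
  have hlt : lam1 < lam1 + 4 * δ := by linarith
  have hd : ∀ x ∈ Set.Ioo lam1 (lam1 + 4 * δ), HasDerivAt u (-(u x * I x - 1) ^ 2) x :=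
    fun x hx => (hu x (Set.Ioo_subset_Icc_self hx)).hasDerivAt (Icc_mem_nhds hx.1 hx.2)
  have hpos : ∀ x ∈ Set.Icc lam1 (lam1 + 4 * δ), 0 < u x := by
    intro x hx
    by_contra hx0
    have hc : ContinuousOn u (Set.Icc lam1 x) :=
      hcont.mono (Set.Icc_subset_Icc_right hx.2)
    obtain ⟨y, hy, hy0⟩ := intermediate_value_Icc' hx.1 hc ⟨not_lt.mp hx0, h0⟩
    exact hne y ⟨hy.1, hy.2.trans hx.2⟩ hy0
  have hanti : AntitoneOn u (Set.Icc lam1 (lam1 + 4 * δ)) := by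
    apply antitoneOn_of_deriv_nonpos (convex_Icc _ _) hcont
    · rw [interior_Icc]
      exact fun x hx => (hd x hx).differentiableAt.differentiableWithinAt
    · rw [interior_Icc]
      intro x hx
      rw [(hd x hx).deriv]
      exact neg_nonpos.mpr (sq_nonneg _)
  obtain ⟨c, hc, hceq⟩ := exists_hasDerivAt_eq_slope u _ hlt hcont hd
  have hcI := Set.Ioo_subset_Icc_self hc
  have hcδ : u c ≤ δ := (hanti (Set.left_mem_Icc.mpr hle) hcI hcI.1).trans h1
  have hc0 := hpos c hcI
  have hb : u c * I c ≤ 1 / 2 :=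
    calc u c * I c ≤ u c * M :=
          mul_le_mul_of_nonneg_left ((le_abs_self _).trans (hI c hcI)) hc0.le
      _ ≤ δ * M := mul_le_mul_of_nonneg_right hcδ hM
      _ ≤ 1 / 2 := hδM
  have hq : 1 / 4 ≤ (u c * I c - 1) ^ 2 := by nlinarith
  have hend := hpos _ (Set.right_mem_Icc.mpr hle)
  rw [eq_div_iff (by linarith)] at hceq
  nlinarith
end
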